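/- Let F : D(Mod A) → D(Mod B) be a triangle functor between derived categories of k-algebras admitting a right adjoint G. If F sends A to a compact object of D(Mod B) (equivalently, F restricts to a functor K^b(proj A) → K^b(proj B)), then G sends complexes with bounded cohomology to complexes with bounded cohomology, i.e., G restricts to a functor D^b(Mod B) → D^b(Mod A). -/

import Mathlib

open CategoryTheory Limits

/-- A complex representing an object of `K^b(proj A)`: a bounded complex of finitely
generated projective modules. -/
def IsKbProjComplex (A : Type) [Ring A] (Q : CochainComplex (ModuleCat A) ℤ) : Prop :=
  (∀ i : ℤ, Projective (Q.X i) ∧ Module.Finite A (Q.X i)) ∧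
  ∃ a b : ℤ, ∀ i : ℤ, (i < a ∨ b < i) → IsZero (Q.X i)

/-- An object of the derived category lies in `K^b(proj A)` (equivalently, is compact)
if it is isomorphic to a bounded complex of finitely generated projectives. -/
def InKbProj (A : Type) [Ring A] [HasDerivedCategory (ModuleCat A)]
    (X : DerivedCategory (ModuleCat A)) : Prop :=
  ∃ Q : CochainComplex (ModuleCat A) ℤ, IsKbProjComplex A Q ∧
    Nonempty (X ≅ DerivedCategory.Q.obj Q)

/-- An object of `D(Mod A)` has bounded cohomology. -/
def HasBoundedCohomology (A : Type) [Ring A] [HasDerivedCategory (ModuleCat A)]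
    (X : DerivedCategory (ModuleCat A)) : Prop :=
  ∃ N : ℕ, ∀ n : ℤ, (N : ℤ) < |n| →
    IsZero ((DerivedCategory.homologyFunctor (ModuleCat A) n).obj X)

/-- If every morphism from the free module of rank one placed in degree `n` to `X` vanishes, then
the cohomology of `X` in degree `n` vanishes. -/
lemma isZero_homology_of_forall_single_hom_eq_zero {A : Type} [Ring A]
    [HasDerivedCategory (ModuleCat A)] (X : DerivedCategory (ModuleCat A)) (n : ℤ)
    (hX : ∀ f : (DerivedCategory.singleFunctor (ModuleCat A) n).obj (ModuleCat.of A A) ⟶ X,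
      f = 0) :
    IsZero ((DerivedCategory.homologyFunctor (ModuleCat A) n).obj X) := by
  obtain ⟨K, ⟨e⟩⟩ : ∃ K, Nonempty (DerivedCategory.Q.obj K ≅ X) :=
    ⟨_, ⟨DerivedCategory.Q.objObjPreimageIso X⟩⟩
  suffices h : IsZero (K.homology n) from
    h.of_iso ((DerivedCategory.homologyFunctor _ n).mapIso e.symm ≪≫
      (DerivedCategory.homologyFunctorFactors _ n).app K)
  suffices h : ∀ x : K.homology n, x = 0 by
    have : Subsingleton (K.homology n) := ⟨fun x y ↦ (h x).trans (h y).symm⟩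
    exact ModuleCat.isZero_of_subsingleton _
  intro x
  obtain ⟨z, rfl⟩ := (ModuleCat.epi_iff_surjective (K.homologyπ n)).1 inferInstance x
  let φ : ModuleCat.of A A ⟶ K.cycles n := ModuleCat.ofHom (LinearMap.toSpanSingleton A _ z)
  let f : (HomologicalComplex.single (ModuleCat A) (.up ℤ) n).obj (ModuleCat.of A A) ⟶ K :=
    HomologicalComplex.mkHomFromSingle (φ ≫ K.iCycles n) (by simp)
  have hf : HomologicalComplex.homologyMap f n = 0 := by
    have hQ : DerivedCategory.Q.map f = 0 := by
      rw [← cancel_mono e.hom, zero_comp]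
      exact hX _
    refine (cancel_epi ((DerivedCategory.homologyFunctorFactors _ n).hom.app _)).1 ?_
    rw [← DerivedCategory.homologyFunctorFactors_hom_naturality, hQ]
    exact (congrArg (· ≫ _) (Functor.map_zero _ _ _)).trans (zero_comp.trans comp_zero.symm)
  have hφ : (HomologicalComplex.singleObjCyclesSelfIso (.up ℤ) n (ModuleCat.of A A)).inv ≫
      HomologicalComplex.cyclesMap f n = φ := by
    simp [← cancel_mono (K.iCycles n), f]
  have h0 : φ ≫ K.homologyπ n = 0 := by
    rw [← hφ, Category.assoc, ← HomologicalComplex.homologyπ_naturality, hf]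
    simp
  have hz : φ (1 : A) = z := LinearMap.toSpanSingleton_apply_one A _ z
  rw [← hz, ← ConcreteCategory.comp_apply, h0]
  rfl

/-- A K-projective complex has no nonzero morphism in the derived category to a
complex supported in disjoint degrees. -/
lemma hom_eq_zero_of_disjoint_support {C : Type*} [Category C] [Abelian C]
    [HasDerivedCategory C] (P K : CochainComplex C ℤ) [P.IsKProjective]
    (h : ∀ i, IsZero (P.X i) ∨ IsZero (K.X i))
    (f : DerivedCategory.Q.obj P ⟶ DerivedCategory.Q.obj K) : f = 0 := by
  obtain ⟨g, hg⟩ := (CochainComplex.IsKProjective.Qh_map_bijective P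
    ((HomotopyCategory.quotient _ _).obj K)).surjective
    ((DerivedCategory.quotientCompQhIso C).hom.app P ≫ f ≫
      (DerivedCategory.quotientCompQhIso C).inv.app K)
  obtain ⟨g, rfl⟩ := (HomotopyCategory.quotient _ _).map_surjective g
  obtain rfl : g = 0 := by
    ext i
    exact (h i).elim (fun h ↦ h.eq_of_src _ _) (fun h ↦ h.eq_of_tgt _ _)
  rw [← cancel_epi ((DerivedCategory.quotientCompQhIso C).hom.app P),
    ← cancel_mono ((DerivedCategory.quotientCompQhIso C).inv.app K), Category.assoc, ← hg]
  simp

/-- let `F : D(Mod A) ⥤ D(Mod B)` be a triangle functor between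
derived categories of `k`-algebras admitting a right adjoint `G`. If `F` sends `A` to a
compact object of `D(Mod B)` (equivalently, `F` restricts to `K^b(proj)`), then `G`
sends complexes with bounded cohomology to complexes with bounded cohomology, i.e. `G`
restricts to a functor `D^b(Mod B) → D^b(Mod A)`. -/
theorem stmt19 {k A B : Type} [CommRing k] [Ring A] [Ring B]
    [Algebra k A] [Algebra k B]
    [HasDerivedCategory (ModuleCat A)] [HasDerivedCategory (ModuleCat B)]
    (F : DerivedCategory (ModuleCat A) ⥤ DerivedCategory (ModuleCat B))
    (G : DerivedCategory (ModuleCat B) ⥤ DerivedCategory (ModuleCat A))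
    [F.CommShift ℤ] [F.IsTriangulated]
    (adj : F ⊣ G)
    (hF : InKbProj B (F.obj
      ((DerivedCategory.singleFunctor (ModuleCat A) 0).obj (ModuleCat.of A A)))) :
    ∀ M : DerivedCategory (ModuleCat B), HasBoundedCohomology B M →
      HasBoundedCohomology A (G.obj M) := by
  rintro M ⟨N, hN⟩
  obtain ⟨P, ⟨hP, a, b, hab⟩, ⟨e⟩⟩ := hF
  have hGE : M.IsGE (-N) := (M.isGE_iff _).2 fun i hi ↦ hN i (by grind)
  have hLE : M.IsLE N := (M.isLE_iff _).2 fun i hi ↦ hN i (by grind)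
  obtain ⟨K, _, _, ⟨e'⟩⟩ := M.exists_iso_Q_obj_of_isGE_of_isLE (-N) N
  have hPle : P.IsStrictlyLE b := by
    rw [CochainComplex.isStrictlyLE_iff]
    exact fun i hi ↦ hab i (.inr hi)
  have (i : ℤ) : Projective (P.X i) := (hP i).1
  have := CochainComplex.isKProjective_of_projective P b
  refine ⟨N + a.natAbs + b.natAbs, fun n hn ↦
    isZero_homology_of_forall_single_hom_eq_zero _ n fun f ↦ ?_⟩
  let e₁ : F.obj ((DerivedCategory.singleFunctor (ModuleCat A) n).obj (ModuleCat.of A A)) ≅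
      DerivedCategory.Q.obj (P⟦-n⟧) :=
    F.mapIso (((DerivedCategory.singleFunctors (ModuleCat A)).shiftIso (-n) n 0
      (by simp)).symm.app _) ≪≫ (F.commShiftIso (-n)).app _ ≪≫
      (shiftFunctor _ (-n)).mapIso e ≪≫ (DerivedCategory.Q.commShiftIso (-n)).symm.app P
  have hzero (g : F.obj ((DerivedCategory.singleFunctor (ModuleCat A) n).obj
      (ModuleCat.of A A)) ⟶ M) : g = 0 := by
    rw [← cancel_epi e₁.inv, ← cancel_mono e'.hom, comp_zero, zero_comp]
    refine hom_eq_zero_of_disjoint_support _ _ (fun i ↦ ?_) _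
    by_cases hi : i - n < a ∨ b < i - n
    · exact .inl (hab (i + -n) hi)
    · refine .inr ?_
      by_cases hiN : i < -N
      · exact K.isZero_of_isStrictlyGE (-N) i hiN
      · exact K.isZero_of_isStrictlyLE N i (by push_cast at hn; grind)
  exact (adj.homEquiv _ _).symm.injective ((hzero _).trans (hzero _).symm)
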